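/- Let f : ℝ → ℝ³ be a C^∞ embedding of period L parametrized by arc length with curvature κ(s) = |f''(s)| > 0 for all s. For j = 1, 2 let P_j ∈ ℝ³ be points not contained in the curvature tube of f, let r_j > 0, and set f̃_j = I_{P_j, r_j}∘f; assume f̃_j'(s) × f̃_j''(s) ≠ 0 for all s (j = 1,2). Then the total torsions of the two inverted knots coincide modulo 2π: ∫₀^L τ_{f̃₁}(s)|f̃₁'(s)| ds − ∫₀^L τ_{f̃₂}(s)|f̃₂'(s)| ds ∈ 2πℤ; equivalently Tω(f̃₁) − Tω(f̃₂) ∈ ℤ. -/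

import Mathlib

noncomputable section
open Real

/-- Euclidean 3-space. -/
abbrev E3 : Type := EuclideanSpace ℝ (Fin 3)

/-- The dot product of two vectors in `E3`. -/
def dot3 (u v : E3) : ℝ := u 0 * v 0 + u 1 * v 1 + u 2 * v 2

/-- The cross product of two vectors in `E3`. -/
def cross3 (u v : E3) : E3 :=
  (WithLp.equiv 2 (Fin 3 → ℝ)).symm
    ![u 1 * v 2 - u 2 * v 1, u 2 * v 0 - u 0 * v 2, u 0 * v 1 - u 1 * v 0]

/-- The determinant `det(u, v, w)` of three vectors in `E3`. -/
def det3 (u v w : E3) : ℝ := dot3 u (cross3 v w)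

/-- The writhe of a closed curve `g` of period `L`, given by the Gauss integral. -/
def writhe (g : ℝ → E3) (L : ℝ) : ℝ :=
  (1 / (4 * π)) * ∫ s in (0:ℝ)..L, ∫ t in (0:ℝ)..L,
    det3 (deriv g s) (deriv g t) (g s - g t) / ‖g s - g t‖ ^ 3

/-- The inversion in the sphere of center `P` and radius `r`. -/
def inv3 (P : E3) (r : ℝ) (x : E3) : E3 := P + (r ^ 2 / ‖x - P‖ ^ 2) • (x - P)

/-- The differential of the inversion `inv3 P r` at `x`, applied to `v`. -/
def dInv (P : E3) (r : ℝ) (x v : E3) : E3 :=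
  (r ^ 2 / ‖x - P‖ ^ 2) • (v - ((2 * dot3 (x - P) v) / ‖x - P‖ ^ 2) • (x - P))

/-- The total twist of a closed curve `g` of period `L` with unit normal framing `w`. -/
def twist (g w : ℝ → E3) (L : ℝ) : ℝ :=
  (1 / (2 * π)) * ∫ s in (0:ℝ)..L,
    dot3 (deriv w s) (cross3 ((‖deriv g s‖)⁻¹ • deriv g s) (w s))

/-- The principal normal `e₂ = f''/κ` of an arc-length parametrized curve. -/
def e2 (f : ℝ → E3) (s : ℝ) : E3 := (‖deriv (deriv f) s‖)⁻¹ • deriv (deriv f) s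

/-- The binormal `e₃ = e₁ × e₂` of an arc-length parametrized curve. -/
def e3 (f : ℝ → E3) (s : ℝ) : E3 := cross3 (deriv f s) (e2 f s)

/-- The torsion `τ = e₂'·e₃` of an arc-length parametrized curve. -/
def torsionArc (f : ℝ → E3) (s : ℝ) : ℝ := dot3 (deriv (e2 f) s) (e3 f s)

/-- The total torsion `Tω = (1/2π) ∫ τ` of an arc-length parametrized closed curve. -/
def totalTorsionArc (f : ℝ → E3) (L : ℝ) : ℝ :=
  (1 / (2 * π)) * ∫ s in (0:ℝ)..L, torsionArc f s

/-- The torsion `τ_g = det(g', g'', g''')/|g' × g''|²` of a regular curve. -/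
def torsionGen (g : ℝ → E3) (s : ℝ) : ℝ :=
  det3 (deriv g s) (deriv (deriv g) s) (deriv (deriv (deriv g)) s) /
    ‖cross3 (deriv g s) (deriv (deriv g) s)‖ ^ 2

/-- The total torsion `Tω = (1/2π) ∫ τ_g |g'|` of a regular closed curve. -/
def totalTorsionGen (g : ℝ → E3) (L : ℝ) : ℝ :=
  (1 / (2 * π)) * ∫ s in (0:ℝ)..L, torsionGen g s * ‖deriv g s‖

/-- The osculating circle at `s` of an arc-length parametrized curve with `κ(s) > 0`:
the circle of center `f(s) + (1/κ(s)) e₂(s)` and radius `1/κ(s)` in the plane through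
`f(s)` spanned by `e₁(s)` and `e₂(s)`. -/
def osculatingCircleArc (f : ℝ → E3) (s : ℝ) : Set E3 :=
  {y | (∃ a b : ℝ, y = f s + a • deriv f s + b • e2 f s) ∧
    ‖y - (f s + (‖deriv (deriv f) s‖)⁻¹ • e2 f s)‖ = (‖deriv (deriv f) s‖)⁻¹}

/-- The curvature tube of `f`: the union of all osculating circles. -/
def curvatureTube (f : ℝ → E3) : Set E3 := ⋃ s : ℝ, osculatingCircleArc f s

lemma norm_sq_eq_dot3 (u : E3) : ‖u‖ ^ 2 = dot3 u u := by
  rw [EuclideanSpace.real_norm_sq_eq, Fin.sum_univ_three]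
  simp only [dot3, sq]

lemma norm_cross3_sq (u v : E3) :
    ‖cross3 u v‖ ^ 2 = dot3 u u * dot3 v v - dot3 u v ^ 2 := by
  rw [norm_sq_eq_dot3]
  simp only [dot3, cross3, WithLp.equiv_symm_apply, Matrix.cons_val]
  ring

lemma det3_eq (u v w : E3) :
    det3 u v w = u 0 * (v 1 * w 2 - v 2 * w 1) + u 1 * (v 2 * w 0 - v 0 * w 2)
      + u 2 * (v 0 * w 1 - v 1 * w 0) := by
  simp only [det3, dot3, cross3, WithLp.equiv_symm_apply, Matrix.cons_val]

/-- The linear relation between four vectors of `E3`, paired with a fifth one. -/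
lemma dot3_mul_det3_relation (y x p q w : E3) :
    dot3 y x * det3 p q w - dot3 y p * det3 x q w + dot3 y q * det3 x p w
      - dot3 y w * det3 x p q = 0 := by
  simp only [det3_eq, dot3]
  ring

lemma sq_det3 (u v w : E3) :
    det3 u v w ^ 2 = dot3 u u * (dot3 v v * dot3 w w - dot3 v w ^ 2)
      - dot3 u v * (dot3 u v * dot3 w w - dot3 v w * dot3 u w)
      + dot3 u w * (dot3 u v * dot3 v w - dot3 v v * dot3 u w) := by
  simp only [det3_eq, dot3]
  ring

lemma dot3_comm (u v : E3) : dot3 u v = dot3 v u := by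
  simp only [dot3]
  ring

lemma HasDerivAt.apply_E3 {u : ℝ → E3} {u' : E3} {s : ℝ} (hu : HasDerivAt u u' s) (i : Fin 3) :
    HasDerivAt (fun t => u t i) (u' i) s :=
  ((EuclideanSpace.proj i : E3 →L[ℝ] ℝ).hasFDerivAt.comp_hasDerivAt s hu)

lemma HasDerivAt.dot3 {u v : ℝ → E3} {u' v' : E3} {s : ℝ} (hu : HasDerivAt u u' s)
    (hv : HasDerivAt v v' s) :
    HasDerivAt (fun t => dot3 (u t) (v t)) (dot3 u' (v s) + dot3 (u s) v') s := by
  have h := (((hu.apply_E3 0).mul (hv.apply_E3 0)).add ((hu.apply_E3 1).mul (hv.apply_E3 1))).add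
    ((hu.apply_E3 2).mul (hv.apply_E3 2))
  refine h.congr_deriv ?_
  simp only [_root_.dot3]
  ring

lemma HasDerivAt.det3 {u v w : ℝ → E3} {u' v' w' : E3} {s : ℝ} (hu : HasDerivAt u u' s)
    (hv : HasDerivAt v v' s) (hw : HasDerivAt w w' s) :
    HasDerivAt (fun t => det3 (u t) (v t) (w t))
      (det3 u' (v s) (w s) + det3 (u s) v' (w s) + det3 (u s) (v s) w') s := by
  have h (i j k : Fin 3) := (hu.apply_E3 i).mul
    (((hv.apply_E3 j).mul (hw.apply_E3 k)).sub ((hv.apply_E3 k).mul (hw.apply_E3 j)))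
  simp only [det3_eq]
  refine (((h 0 1 2).add (h 1 2 0)).add (h 2 0 1)).congr_deriv ?_
  simp only [Pi.mul_apply, Pi.sub_apply]
  ring

/-- The total change of argument along a closed nonvanishing plane curve is a multiple of `2π`. -/
lemma exists_int_integral_angular_form {A B A' B' : ℝ → ℝ} {L : ℝ}
    (hA : ∀ s, HasDerivAt A (A' s) s) (hB : ∀ s, HasDerivAt B (B' s) s)
    (hA' : Continuous A') (hB' : Continuous B') (h0 : ∀ s, A s ^ 2 + B s ^ 2 ≠ 0)
    (hAL : A L = A 0) (hBL : B L = B 0) :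
    ∃ k : ℤ, ∫ s in (0 : ℝ)..L, (A s * B' s - B s * A' s) / (A s ^ 2 + B s ^ 2)
      = 2 * π * (k : ℝ) := by
  set h : ℝ → ℂ := fun s => (A s : ℂ) + (B s : ℂ) * Complex.I with hh
  set h' : ℝ → ℂ := fun s => (A' s : ℂ) + (B' s : ℂ) * Complex.I with hh'
  have hd (s) : HasDerivAt h (h' s) s :=
    (hA s).ofReal_comp.add ((hB s).ofReal_comp.mul_const _)
  have hne (s) : h s ≠ 0 := by
    intro hs
    have hre : A s = 0 := by simpa [hh] using congrArg Complex.re hs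
    have him : B s = 0 := by simpa [hh] using congrArg Complex.im hs
    exact h0 s (by simp [hre, him])
  have hc : Continuous h := continuous_iff_continuousAt.2 fun s => (hd s).continuousAt
  have hc' : Continuous h' := by fun_prop
  have hq : Continuous fun s => h' s / h s := hc'.div hc hne
  set G : ℝ → ℂ := fun t => ∫ s in (0 : ℝ)..t, h' s / h s with hG
  have hGd (t) : HasDerivAt G (h' t / h t) t :=
    intervalIntegral.integral_hasDerivAt_right (hq.intervalIntegrable _ _)
      (hq.stronglyMeasurableAtFilter _ _) hq.continuousAt
  have hconst (t) : HasDerivAt (fun t => Complex.exp (-G t) * h t) 0 t := by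
    refine ((hGd t).neg.cexp.mul (hd t)).congr_deriv ?_
    have := hne t
    field_simp
    ring
  have hexp : Complex.exp (-G L) * h L = Complex.exp (-G 0) * h 0 :=
    is_const_of_deriv_eq_zero (fun t => (hconst t).differentiableAt) (fun t => (hconst t).deriv) L 0
  have hL0 : h L = h 0 := by simp only [hh, hAL, hBL]
  have hG0 : G 0 = 0 := by simp [hG]
  rw [hL0, hG0, neg_zero] at hexp
  obtain ⟨n, hn⟩ := Complex.exp_eq_one_iff.1 ((mul_right_cancel₀ (hne 0) hexp).trans Complex.exp_zero)
  refine ⟨-n, ?_⟩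
  have him : ∫ s in (0 : ℝ)..L, (A s * B' s - B s * A' s) / (A s ^ 2 + B s ^ 2) = (G L).im := by
    rw [hG, ← Complex.imCLM_apply,
      ← ContinuousLinearMap.intervalIntegral_comp_comm _ (hq.intervalIntegrable _ _)]
    refine intervalIntegral.integral_congr fun s _ => ?_
    have := h0 s
    simp [hh, hh', Complex.div_im, Complex.normSq_apply, ← sq]
    field_simp
  rw [him, ← neg_neg (G L), hn]
  simp
  ring

section Leibniz

variable {μ μ₁ μ₂ μ₃ : ℝ → ℝ} {x p q w : ℝ → E3} {P : E3}

lemma deriv_const_add_smul (hμ : ∀ s, HasDerivAt μ (μ₁ s) s) (hx : ∀ s, HasDerivAt x (p s) s) :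
    deriv (fun t => P + μ t • x t) = fun t => μ₁ t • x t + μ t • p t := by
  ext1 s
  rw [add_comm]
  exact (((hμ s).smul (hx s)).const_add P).deriv

lemma deriv_deriv_const_add_smul (hμ : ∀ s, HasDerivAt μ (μ₁ s) s)
    (hμ₁ : ∀ s, HasDerivAt μ₁ (μ₂ s) s) (hx : ∀ s, HasDerivAt x (p s) s)
    (hp : ∀ s, HasDerivAt p (q s) s) :
    deriv (deriv (fun t => P + μ t • x t)) =
      fun t => μ₂ t • x t + (2 * μ₁ t) • p t + μ t • q t := by
  rw [deriv_const_add_smul hμ hx]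
  ext1 s
  refine (((hμ₁ s).smul (hx s)).add ((hμ s).smul (hp s))).deriv.trans ?_
  module

lemma deriv_deriv_deriv_const_add_smul (hμ : ∀ s, HasDerivAt μ (μ₁ s) s)
    (hμ₁ : ∀ s, HasDerivAt μ₁ (μ₂ s) s) (hμ₂ : ∀ s, HasDerivAt μ₂ (μ₃ s) s)
    (hx : ∀ s, HasDerivAt x (p s) s) (hp : ∀ s, HasDerivAt p (q s) s)
    (hq : ∀ s, HasDerivAt q (w s) s) :
    deriv (deriv (deriv (fun t => P + μ t • x t))) =
      fun t => μ₃ t • x t + (3 * μ₂ t) • p t + (3 * μ₁ t) • q t + μ t • w t := by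
  rw [deriv_deriv_const_add_smul hμ hμ₁ hx hp]
  ext1 s
  refine ((((hμ₂ s).smul (hx s)).add (((hμ₁ s).const_mul 2).smul (hp s))).add
    ((hμ s).smul (hq s))).deriv.trans ?_
  module

end Leibniz

lemma dot3_combination (a b a' b' c' : ℝ) (x p q : E3) :
    dot3 (a • x + b • p) (a' • x + b' • p + c' • q) =
      a * a' * dot3 x x + (a * b' + b * a') * dot3 x p + b * b' * dot3 p p
        + a * c' * dot3 x q + b * c' * dot3 p q := by
  simp only [dot3, PiLp.add_apply, PiLp.smul_apply, smul_eq_mul]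
  ring

lemma dot3_combination_self (a b c : ℝ) (x p q : E3) :
    dot3 (a • x + b • p + c • q) (a • x + b • p + c • q) =
      a ^ 2 * dot3 x x + b ^ 2 * dot3 p p + c ^ 2 * dot3 q q + 2 * a * b * dot3 x p
        + 2 * a * c * dot3 x q + 2 * b * c * dot3 p q := by
  simp only [dot3, PiLp.add_apply, PiLp.smul_apply, smul_eq_mul]
  ring

lemma det3_combination (a b a' b' c' a'' b'' c'' d'' : ℝ) (x p q w : E3) :
    det3 (a • x + b • p) (a' • x + b' • p + c' • q) (a'' • x + b'' • p + c'' • q + d'' • w) =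
      (a * (b' * c'' - c' * b'') - b * (a' * c'' - c' * a'')) * det3 x p q
        + d'' * (a * b' - b * a') * det3 x p w + d'' * a * c' * det3 x q w
        + d'' * b * c' * det3 p q w := by
  simp only [det3_eq, PiLp.add_apply, PiLp.smul_apply, smul_eq_mul]
  ring

/-- The functions `A`, `B` are, up to a common positive factor, the components of the curvature
vector of the inverted curve in the image of the normal frame `(f'', f' × f'')` of `f`. Here
`x = f - P`, `p = f'`, `q = f''`. -/
def normalA (x q : E3) : ℝ := dot3 q q * dot3 x x + 2 * dot3 x q

/-- See `normalA`. -/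
def normalB (x p q : E3) : ℝ := 2 * det3 x p q

/-- The derivative of `normalA` along an arc-length parametrized curve. -/
def normalA' (x p q w : E3) : ℝ :=
  2 * dot3 q w * dot3 x x + 2 * dot3 q q * dot3 x p + 2 * dot3 x w

/-- The derivative of `normalB` along a curve. -/
def normalB' (x p w : E3) : ℝ := 2 * det3 x p w

/-- Torsion density of the inverted curve, as an identity between the derivatives up to order
three. -/
lemma inversion_torsion_identity {x p q w : E3} {r : ℝ} (hr : 0 < r) (hρ : 0 < dot3 x x)
    (hK : 0 < dot3 q q) (hpp : dot3 p p = 1) (hpq : dot3 p q = 0) (hpw : dot3 p w = -dot3 q q)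
    {μ μ₁ μ₂ μ₃ : ℝ} {g₁ g₂ g₃ : E3}
    (hμ : μ = r ^ 2 / dot3 x x) (hμ₁ : μ₁ = -(2 * r ^ 2 * dot3 x p) / dot3 x x ^ 2)
    (hμ₂ : μ₂ = -(2 * r ^ 2 * (1 + dot3 x q)) / dot3 x x ^ 2
      + 8 * r ^ 2 * dot3 x p ^ 2 / dot3 x x ^ 3)
    (hμ₃ : μ₃ = -(2 * r ^ 2 * dot3 x w) / dot3 x x ^ 2
      + 24 * r ^ 2 * dot3 x p * (1 + dot3 x q) / dot3 x x ^ 3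
      - 48 * r ^ 2 * dot3 x p ^ 3 / dot3 x x ^ 4)
    (hg₁ : g₁ = μ₁ • x + μ • p) (hg₂ : g₂ = μ₂ • x + (2 * μ₁) • p + μ • q)
    (hg₃ : g₃ = μ₃ • x + (3 * μ₂) • p + (3 * μ₁) • q + μ • w) (hreg : cross3 g₁ g₂ ≠ 0) :
    normalA x q ^ 2 + normalB x p q ^ 2 ≠ 0 ∧
    det3 g₁ g₂ g₃ / ‖cross3 g₁ g₂‖ ^ 2 * ‖g₁‖ =
      -(det3 p q w / dot3 q q) -
        (normalA x q * normalB' x p w - normalB x p q * normalA' x p q w) /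
          (normalA x q ^ 2 + normalB x p q ^ 2) := by
  have rx := dot3_mul_det3_relation x x p q w
  have rp := dot3_mul_det3_relation p x p q w
  have rq := dot3_mul_det3_relation q x p q w
  have hF := sq_det3 x p q
  rw [dot3_comm p x, hpp, hpq, hpw] at rp
  rw [dot3_comm q x, dot3_comm q p, hpq] at rq
  rw [hpp, hpq] at hF
  have hμ0 : 0 < μ := by rw [hμ]; positivity
  have hg₁₁ : dot3 g₁ g₁ = μ ^ 2 := by
    have h := dot3_combination_self μ₁ μ 0 x p q
    simp only [zero_smul, add_zero] at h
    rw [hg₁, h, hpp, hμ, hμ₁]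
    field_simp
    ring
  have hnorm : ‖g₁‖ = μ := by
    rw [← sq_eq_sq₀ (norm_nonneg _) hμ0.le, norm_sq_eq_dot3, hg₁₁]
  have hcross : ‖cross3 g₁ g₂‖ ^ 2 * (dot3 q q * dot3 x x ^ 2) =
      μ ^ 4 * (normalA x q ^ 2 + normalB x p q ^ 2) := by
    rw [norm_cross3_sq, hg₁₁, hg₁, hg₂, dot3_combination, dot3_combination_self, hpp, hpq,
      normalA, normalB, mul_pow 2 (det3 x p q), hF, hμ, hμ₁, hμ₂]
    field_simp
    ring
  have hdet : det3 g₁ g₂ g₃ * dot3 x x = -μ ^ 3 * (dot3 x x * det3 p q w - 2 * det3 x p w) := by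
    rw [hg₁, hg₂, hg₃, det3_combination, hμ, hμ₁, hμ₂, hμ₃]
    generalize dot3 x x = ρ at *
    generalize dot3 x p = c at *
    generalize dot3 x q = d at *
    generalize dot3 x w = e at *
    generalize det3 x q w = G at *
    generalize det3 p q w = D at *
    generalize det3 x p q = F at *
    generalize det3 x p w = E at *
    generalize dot3 q q = K at *
    have hG : G = c * D + K * F := by linarith
    subst hG
    field_simp
    linear_combination 2 * ρ ^ 2 * rx
  have hcpos : 0 < ‖cross3 g₁ g₂‖ := norm_pos_iff.2 hreg
  have hN : 0 < normalA x q ^ 2 + normalB x p q ^ 2 := by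
    have : 0 < μ ^ 4 * (normalA x q ^ 2 + normalB x p q ^ 2) := by rw [← hcross]; positivity
    exact pos_of_mul_pos_right this (by positivity)
  have hform : dot3 q q ^ 2 * dot3 x x * (dot3 x x * det3 p q w - 2 * det3 x p w) =
      (normalA x q ^ 2 + normalB x p q ^ 2) * det3 p q w
        + dot3 q q * (normalA x q * normalB' x p w - normalB x p q * normalA' x p q w) := by
    rw [normalA, normalB, normalA', normalB', mul_pow 2, hF]
    linear_combination (-4 : ℝ) * dot3 q q * (dot3 x x * rq + rx - dot3 x p * rp)
  refine ⟨hN.ne', ?_⟩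
  have hdet' : det3 g₁ g₂ g₃ =
      -μ ^ 3 * (dot3 x x * det3 p q w - 2 * det3 x p w) / dot3 x x := by
    rw [eq_div_iff hρ.ne', hdet]
  have hcross' : ‖cross3 g₁ g₂‖ ^ 2 =
      μ ^ 4 * (normalA x q ^ 2 + normalB x p q ^ 2) / (dot3 q q * dot3 x x ^ 2) := by
    rw [eq_div_iff (by positivity), hcross]
  rw [hnorm, hdet', hcross']
  generalize normalA x q ^ 2 + normalB x p q ^ 2 = N at *
  field_simp
  linear_combination -hform

/-- The total torsion of an inverted curve agrees with minus that of the curve modulo `2π`. -/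
lemma exists_int_integral_torsionGen_inversion {f : ℝ → E3} {L : ℝ}
    (hf : ContDiff ℝ (⊤ : ℕ∞) f) (hper : Function.Periodic f L)
    (harc : ∀ s, ‖deriv f s‖ = 1) (hκ : ∀ s, 0 < ‖deriv (deriv f) s‖)
    {P : E3} (hP : ∀ s, f s ≠ P) {r : ℝ} (hr : 0 < r)
    (hreg : ∀ s, cross3 (deriv (fun t => inv3 P r (f t)) s)
        (deriv (deriv (fun t => inv3 P r (f t))) s) ≠ 0) :
    ∃ k : ℤ, ∫ s in (0 : ℝ)..L,
        torsionGen (fun t => inv3 P r (f t)) s * ‖deriv (fun t => inv3 P r (f t)) s‖ =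
      -(∫ s in (0 : ℝ)..L, det3 (deriv f s) (deriv (deriv f) s) (deriv (deriv (deriv f)) s) /
          dot3 (deriv (deriv f) s) (deriv (deriv f) s)) - 2 * π * (k : ℝ) := by
  obtain ⟨hd, hf₁⟩ := contDiff_infty_iff_deriv.1 hf
  obtain ⟨hd₁, hf₂⟩ := contDiff_infty_iff_deriv.1 hf₁
  obtain ⟨hd₂, hf₃⟩ := contDiff_infty_iff_deriv.1 hf₂
  obtain ⟨hd₃, -⟩ := contDiff_infty_iff_deriv.1 hf₃
  set p : ℝ → E3 := deriv f with hp_def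
  set q : ℝ → E3 := deriv p with hq_def
  set w : ℝ → E3 := deriv q
  set x : ℝ → E3 := fun t => f t - P with hx_def
  have hx (s) : HasDerivAt x (p s) s := (hd s).hasDerivAt.sub_const P
  have hp (s) : HasDerivAt p (q s) s := (hd₁ s).hasDerivAt
  have hq (s) : HasDerivAt q (w s) s := (hd₂ s).hasDerivAt
  have hw (s) : HasDerivAt w (deriv w s) s := (hd₃ s).hasDerivAt
  have hρ (s) : 0 < dot3 (x s) (x s) := by
    rw [← norm_sq_eq_dot3]
    exact pow_pos (norm_pos_iff.2 (sub_ne_zero.2 (hP s))) 2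
  have hK (s) : 0 < dot3 (q s) (q s) := by
    rw [← norm_sq_eq_dot3]
    exact pow_pos (hκ s) 2
  have hpp (s) : dot3 (p s) (p s) = 1 := by rw [← norm_sq_eq_dot3, harc, one_pow]
  have hpq (s) : dot3 (p s) (q s) = 0 := by
    have h := (hp s).dot3 (hp s)
    simp only [hpp] at h
    have := h.unique (hasDerivAt_const s (1 : ℝ))
    rw [dot3_comm (q s)] at this
    linarith
  have hpw (s) : dot3 (p s) (w s) = -dot3 (q s) (q s) := by
    have h := (hp s).dot3 (hq s)
    simp only [hpq] at h
    have := h.unique (hasDerivAt_const s (0 : ℝ))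
    linarith
  have hρd (s) : HasDerivAt (fun t => dot3 (x t) (x t)) (2 * dot3 (x s) (p s)) s := by
    refine ((hx s).dot3 (hx s)).congr_deriv ?_
    rw [dot3_comm (p s)]
    ring
  have hcd (s) : HasDerivAt (fun t => dot3 (x t) (p t)) (1 + dot3 (x s) (q s)) s := by
    refine ((hx s).dot3 (hp s)).congr_deriv ?_
    rw [hpp]
  have hdd (s) : HasDerivAt (fun t => dot3 (x t) (q t)) (dot3 (x s) (w s)) s := by
    refine ((hx s).dot3 (hq s)).congr_deriv ?_
    rw [hpq, zero_add]
  set μ : ℝ → ℝ := fun t => r ^ 2 / dot3 (x t) (x t) with hμ_def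
  set μ₁ : ℝ → ℝ := fun t => -(2 * r ^ 2 * dot3 (x t) (p t)) / dot3 (x t) (x t) ^ 2 with hμ₁_def
  set μ₂ : ℝ → ℝ := fun t => -(2 * r ^ 2 * (1 + dot3 (x t) (q t))) / dot3 (x t) (x t) ^ 2
      + 8 * r ^ 2 * dot3 (x t) (p t) ^ 2 / dot3 (x t) (x t) ^ 3 with hμ₂_def
  set μ₃ : ℝ → ℝ := fun t => -(2 * r ^ 2 * dot3 (x t) (w t)) / dot3 (x t) (x t) ^ 2
      + 24 * r ^ 2 * dot3 (x t) (p t) * (1 + dot3 (x t) (q t)) / dot3 (x t) (x t) ^ 3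
      - 48 * r ^ 2 * dot3 (x t) (p t) ^ 3 / dot3 (x t) (x t) ^ 4 with hμ₃_def
  have hμ (s) : HasDerivAt μ (μ₁ s) s := by
    refine ((hasDerivAt_const s (r ^ 2)).div (hρd s) (hρ s).ne').congr_deriv ?_
    simp only [hμ₁_def]
    ring
  have hμ₁ (s) : HasDerivAt μ₁ (μ₂ s) s := by
    refine (((hcd s).const_mul (2 * r ^ 2)).neg.div ((hρd s).pow 2)
      (pow_ne_zero _ (hρ s).ne')).congr_deriv ?_
    simp only [hμ₂_def, Pi.neg_apply, Pi.pow_apply]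
    have := (hρ s).ne'
    field_simp
    ring
  have hμ₂ (s) : HasDerivAt μ₂ (μ₃ s) s := by
    refine ((((hdd s).const_add 1).const_mul (2 * r ^ 2)).neg.div ((hρd s).pow 2)
      (pow_ne_zero _ (hρ s).ne') |>.add ((((hcd s).pow 2).const_mul (8 * r ^ 2)).div
        ((hρd s).pow 3) (pow_ne_zero _ (hρ s).ne'))).congr_deriv ?_
    simp only [hμ₃_def, Pi.neg_apply, Pi.pow_apply]
    have := (hρ s).ne'
    field_simp
    ring
  have hg : (fun t => inv3 P r (f t)) = fun t => P + μ t • x t := by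
    ext1 t
    simp only [inv3, norm_sq_eq_dot3, hμ_def, hx_def]
  have hid (s) := inversion_torsion_identity hr (hρ s) (hK s) (hpp s) (hpq s) (hpw s)
    (μ := μ s) (μ₁ := μ₁ s) (μ₂ := μ₂ s) (μ₃ := μ₃ s) rfl rfl rfl rfl rfl rfl rfl
    (by
      have h := hreg s
      rwa [hg, deriv_deriv_const_add_smul hμ hμ₁ hx hp, deriv_const_add_smul hμ hx] at h)
  have hint (s) : torsionGen (fun t => inv3 P r (f t)) s * ‖deriv (fun t => inv3 P r (f t)) s‖ =
      -(det3 (p s) (q s) (w s) / dot3 (q s) (q s)) -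
        (normalA (x s) (q s) * normalB' (x s) (p s) (w s) -
          normalB (x s) (p s) (q s) * normalA' (x s) (p s) (q s) (w s)) /
          (normalA (x s) (q s) ^ 2 + normalB (x s) (p s) (q s) ^ 2) := by
    rw [torsionGen, hg, deriv_deriv_deriv_const_add_smul hμ hμ₁ hμ₂ hx hp hq,
      deriv_deriv_const_add_smul hμ hμ₁ hx hp, deriv_const_add_smul hμ hx]
    exact (hid s).2
  have hA (s) : HasDerivAt (fun t => normalA (x t) (q t))
      (normalA' (x s) (p s) (q s) (w s)) s := by
    refine ((((hq s).dot3 (hq s)).mul (hρd s)).add ((hdd s).const_mul 2)).congr_deriv ?_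
    rw [normalA', dot3_comm (w s)]
    ring
  have hB (s) : HasDerivAt (fun t => normalB (x t) (p t) (q t))
      (normalB' (x s) (p s) (w s)) s := by
    refine (((hx s).det3 (hp s) (hq s)).const_mul 2).congr_deriv ?_
    simp only [normalB', det3_eq]
    ring
  have cdot {u v u' v' : ℝ → E3} (hu : ∀ s, HasDerivAt u (u' s) s)
      (hv : ∀ s, HasDerivAt v (v' s) s) : Continuous fun s => dot3 (u s) (v s) :=
    continuous_iff_continuousAt.2 fun s => ((hu s).dot3 (hv s)).continuousAt
  have hA' : Continuous fun s => normalA' (x s) (p s) (q s) (w s) := by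
    have h₁ := cdot hq hw
    have h₂ := cdot hx hx
    have h₃ := cdot hq hq
    have h₄ := cdot hx hp
    have h₅ := cdot hx hw
    simp only [normalA']
    fun_prop
  have hB' : Continuous fun s => normalB' (x s) (p s) (w s) :=
    continuous_iff_continuousAt.2 fun s => (((hx s).det3 (hp s) (hw s)).const_mul 2).continuousAt
  have hD : Continuous fun s => det3 (p s) (q s) (w s) / dot3 (q s) (q s) :=
    (continuous_iff_continuousAt.2 fun s => ((hp s).det3 (hq s) (hw s)).continuousAt).div
      (cdot hq hq) fun s => (hK s).ne'
  have hxL : x L = x 0 := by simp only [hx_def, ← hper 0, zero_add]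
  have hpper : Function.Periodic p L := fun s => by
    rw [hp_def, ← deriv_comp_add_const, hper.funext]
  have hqper : Function.Periodic q L := fun s => by
    rw [hq_def, ← deriv_comp_add_const, hpper.funext]
  have hpL : p L = p 0 := by simpa using hpper 0
  have hqL : q L = q 0 := by simpa using hqper 0
  obtain ⟨k, hk⟩ := exists_int_integral_angular_form (L := L) hA hB hA' hB' (fun s => (hid s).1)
    (by rw [hxL, hqL]) (by rw [hxL, hpL, hqL])
  refine ⟨k, ?_⟩
  have hW : Continuous fun s => (normalA (x s) (q s) * normalB' (x s) (p s) (w s) -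
      normalB (x s) (p s) (q s) * normalA' (x s) (p s) (q s) (w s)) /
        (normalA (x s) (q s) ^ 2 + normalB (x s) (p s) (q s) ^ 2) := by
    have cA : Continuous fun t => normalA (x t) (q t) :=
      continuous_iff_continuousAt.2 fun s => (hA s).continuousAt
    have cB : Continuous fun t => normalB (x t) (p t) (q t) :=
      continuous_iff_continuousAt.2 fun s => (hB s).continuousAt
    exact ((cA.mul hB').sub (cB.mul hA')).div ((cA.pow 2).add (cB.pow 2)) fun s => (hid s).1
  simp only [hint]
  rw [intervalIntegral.integral_sub (f := fun s => -(det3 (p s) (q s) (w s) / dot3 (q s) (q s)))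
    (hD.neg.intervalIntegrable _ _) (hW.intervalIntegrable _ _),
    intervalIntegral.integral_neg, hk]

lemma ne_of_notMem_curvatureTube {f : ℝ → E3} (hκ : ∀ s, 0 < ‖deriv (deriv f) s‖) {P : E3}
    (hP : P ∉ curvatureTube f) (s : ℝ) : f s ≠ P := by
  rintro rfl
  refine hP (Set.mem_iUnion.2 ⟨s, ⟨0, 0, by simp⟩, ?_⟩)
  have h := (hκ s).ne'
  rw [sub_add_cancel_left, norm_neg, e2, norm_smul, norm_smul, norm_inv, norm_norm,
    inv_mul_cancel₀ h, mul_one]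

/-- Corollary 5. If `P₁, P₂` are outside the curvature tube of `f`
and both inverted knots are regular with nowhere vanishing curvature, then their
total torsions agree modulo `2π`:
`∫ τ_{f̃₁}|f̃₁'| − ∫ τ_{f̃₂}|f̃₂'| ∈ 2πℤ`, i.e. `Tω(f̃₁) − Tω(f̃₂) ∈ ℤ`. -/
theorem totalTorsion_two_inversions
    (f : ℝ → E3) (L : ℝ) (hL : 0 < L)
    (hf : ContDiff ℝ (⊤ : ℕ∞) f) (hper : Function.Periodic f L)
    (harc : ∀ s, ‖deriv f s‖ = 1) (hinj : Set.InjOn f (Set.Ico 0 L))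
    (hκ : ∀ s, ‖deriv (deriv f) s‖ > 0)
    (P₁ P₂ : E3) (hP₁ : P₁ ∉ curvatureTube f) (hP₂ : P₂ ∉ curvatureTube f)
    (r₁ r₂ : ℝ) (hr₁ : 0 < r₁) (hr₂ : 0 < r₂)
    (hreg₁ : ∀ s, cross3 (deriv (fun t => inv3 P₁ r₁ (f t)) s)
        (deriv (deriv (fun t => inv3 P₁ r₁ (f t))) s) ≠ 0)
    (hreg₂ : ∀ s, cross3 (deriv (fun t => inv3 P₂ r₂ (f t)) s)
        (deriv (deriv (fun t => inv3 P₂ r₂ (f t))) s) ≠ 0) :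
    ∃ k : ℤ,
      (∫ s in (0:ℝ)..L,
          torsionGen (fun t => inv3 P₁ r₁ (f t)) s * ‖deriv (fun t => inv3 P₁ r₁ (f t)) s‖)
        - (∫ s in (0:ℝ)..L,
            torsionGen (fun t => inv3 P₂ r₂ (f t)) s * ‖deriv (fun t => inv3 P₂ r₂ (f t)) s‖)
        = 2 * π * (k : ℝ) := by
  obtain ⟨k₁, h₁⟩ := exists_int_integral_torsionGen_inversion hf hper harc hκ
    (ne_of_notMem_curvatureTube hκ hP₁) hr₁ hreg₁
  obtain ⟨k₂, h₂⟩ := exists_int_integral_torsionGen_inversion hf hper harc hκ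
    (ne_of_notMem_curvatureTube hκ hP₂) hr₂ hreg₂
  refine ⟨k₂ - k₁, ?_⟩
  rw [h₁, h₂]
  push_cast
  ring
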